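/- Let C > 0 and t₂ ∈ ℝ. There is no continuously differentiable function F : [t₂,∞) → ℝ satisfying F'(t) ≤ −C ∫_{t₂}^{t} e^{−F(s)/4} ds for all t ≥ t₂. Equivalently, any continuously differentiable F : [t₂,T) → ℝ satisfying this differential inequality on a maximal interval of existence must have T < ∞ and F(t) → −∞ as t → T⁻. (This is the differential inequality satisfied by the blow-up front F₂ of the hyperbolic Boussinesq system, and it forces the front to reach −∞ in finite time.) -/

import Mathlib

open MeasureTheory Real

/-- A function with `G' ≥ m (1 + G ^ 2)` for some `m > 0` cannot exist on a whole half-line. -/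
lemma not_forall_riccati_le {G g : ℝ → ℝ} {m a : ℝ} (hm : 0 < m)
    (hG : ∀ t ∈ Set.Ici a, HasDerivAt G (g t) t) :
    ¬ ∀ t ∈ Set.Ici a, m * (1 + G t ^ 2) ≤ g t := by
  intro h
  have hd : ∀ t ∈ Set.Ici a, HasDerivAt (fun t => arctan (G t) - m * t)
      (1 / (1 + G t ^ 2) * g t - m * 1) t := fun t ht =>
    (hG t ht).arctan.sub ((hasDerivAt_id t).const_mul m)
  have hmono : MonotoneOn (fun t => arctan (G t) - m * t) (Set.Ici a) := by
    refine monotoneOn_of_hasDerivWithinAt_nonneg (convex_Ici a)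
      (fun t ht => (hd t ht).continuousAt.continuousWithinAt)
      (fun t ht => (hd t (interior_subset ht)).hasDerivWithinAt) fun t ht => ?_
    have hpos : 0 < 1 + G t ^ 2 := by positivity
    have := (le_div_iff₀ hpos).2 (h t (interior_subset ht))
    rw [one_div_mul_eq_div]
    linarith
  have hle : a ≤ a + π / m := by have := div_pos pi_pos hm; linarith
  have key := hmono Set.self_mem_Ici hle hle
  have hmul : m * (a + π / m) = m * a + π := by field_simp
  simp only [hmul] at key
  linarith [arctan_lt_pi_div_two (G (a + π / m)), neg_pi_div_two_lt_arctan (G a)]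

/-- No continuously differentiable function `F : [t₂,∞) → ℝ` can satisfy the
differential inequality `F'(t) ≤ -C ∫_{t₂}^t e^{-F(s)/4} ds` for all `t ≥ t₂`:
the inequality forces blow-up of `F` to `-∞` in finite time. -/
theorem stmt_19 (C t₂ : ℝ) (hC : 0 < C) :
    ¬ ∃ F F' : ℝ → ℝ,
        (∀ t ∈ Set.Ici t₂, HasDerivAt F (F' t) t) ∧
        ContinuousOn F' (Set.Ici t₂) ∧
        (∀ t ∈ Set.Ici t₂, F' t ≤ -C * ∫ s in t₂..t, Real.exp (-F s / 4)) := by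
  rintro ⟨F, F', hF, -, hle⟩
  -- Extend `exp (-F / 4)` continuously to the left of `t₂`.
  let f : ℝ → ℝ := fun s => exp (-F (max t₂ s) / 4)
  have hFc : Continuous fun s => F (max t₂ s) := continuous_iff_continuousAt.2 fun s =>
    ContinuousAt.comp (f := fun s => max t₂ s) (hF _ (le_max_left t₂ s)).continuousAt (by fun_prop)
  have hfc : Continuous f := continuous_exp.comp (hFc.neg.div_const 4)
  have hf : ∀ t ∈ Set.Ici t₂, f t = exp (-F t / 4) := fun t ht => by
    simp only [f, max_eq_right (Set.mem_Ici.1 ht)]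
  let G : ℝ → ℝ := fun t => ∫ s in t₂..t, f s
  have hG : ∀ t, HasDerivAt G (f t) t := fun t => hfc.integral_hasStrictDerivAt t₂ t |>.hasDerivAt
  have hGeq : ∀ t ∈ Set.Ici t₂, ∫ s in t₂..t, exp (-F s / 4) = G t := fun t ht =>
    intervalIntegral.integral_congr fun s hs => by
      rw [Set.uIcc_of_le ht] at hs
      exact (hf s hs.1).symm
  have hd : ∀ t ∈ Set.Ici t₂, HasDerivAt (fun t => exp (-F t / 4) - C / 8 * G t ^ 2)
      (exp (-F t / 4) * (-F' t / 4) - C / 8 * (2 * G t * f t)) t := fun t ht => by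
    have h2 := ((hG t).pow 2).const_mul (C / 8)
    simp only [Nat.cast_ofNat, Nat.add_one_sub_one, pow_one] at h2
    exact ((hF t ht).neg.div_const 4).exp.sub h2
  have hmono : MonotoneOn (fun t => exp (-F t / 4) - C / 8 * G t ^ 2) (Set.Ici t₂) := by
    refine monotoneOn_of_hasDerivWithinAt_nonneg (convex_Ici t₂)
      (fun t ht => (hd t ht).continuousAt.continuousWithinAt)
      (fun t ht => (hd t (interior_subset ht)).hasDerivWithinAt) fun t ht => ?_
    have ht' := interior_subset ht
    have h1 := hle t ht'
    rw [hGeq t ht'] at h1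
    rw [hf t ht']
    nlinarith [mul_le_mul_of_nonneg_left h1 (exp_pos (-F t / 4)).le]
  refine not_forall_riccati_le (m := min (exp (-F t₂ / 4)) (C / 8))
    (lt_min (exp_pos _) (by positivity)) (fun t _ => hG t) (a := t₂) fun t ht => ?_
  have key := hmono Set.self_mem_Ici ht ht
  have hG0 : G t₂ = 0 := intervalIntegral.integral_same
  simp only [hG0] at key
  rw [hf t ht]
  nlinarith [min_le_left (exp (-F t₂ / 4)) (C / 8),
    mul_le_mul_of_nonneg_right (min_le_right (exp (-F t₂ / 4)) (C / 8)) (sq_nonneg (G t))]
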